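/- arXiv:2008.00654 — 5 statements merged into one kernel-verified Lean document; each statement's English description precedes it below -/
import Mathlib

section
/- (Content of the Main Theorem, Theorem 4.2.) Let p be a prime, q = p^m, and for each k ∈ {1,…,r} and j ∈ {1,…,ℓ} let C_{kj} be an F_q-linear code of length n. For each k let m_k : Fin ℓ → Fin n → F_q be a matrix whose j-th row lies in C_{kj} (i.e., m_k is an element of the ℓ-fold joint code Π_k^ℓ). Let τ be the permutation of (Fin n) × (Fin ℓ → F_q) defined by τ(i, x) = (i, x + ∑_{k=1}^{r} (column i of m_k)), where column i of m_k is the vector j ↦ m_k(j)(i). Set wt := #{i : ∑_{k=1}^{r} (column i of m_k) ≠ 0}. Then: (a) the number of fixed points of τ is q^ℓ·(n − wt); (b) every orbit of τ has cardinality 1 or p; (c) the number of orbits of τ of cardinality p is (q^ℓ/p)·wt. Consequently the monomial contributed by (m_1,…,m_r) to the r-fold complete joint cycle index is s((m_1,…,m_r),1)^{q^ℓ(n−wt)} · s((m_1,…,m_r),p)^{(q^ℓ/p)·wt}, which under the substitution of Theorem 4.2 becomes ∏_{i=1}^{n} x_{(column i of m_1, …, column i of m_r)}, the contribution of (m_1,…,m_r)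 to the (ℓ,r)-fold complete joint weight enumerator. -/
/-- The orbit of a point under the cyclic group generated by a permutation. -/
def permOrbit {α : Type*} (τ : Equiv.Perm α) (x : α) : Set α :=
  {y | ∃ n : ℤ, (τ ^ n) x = y}

theorem mem_permOrbit_self {α : Type*} (σ : Equiv.Perm α) (x : α) : x ∈ permOrbit σ x :=
  ⟨0, rfl⟩

theorem permOrbit_eq_iff {α : Type*} {σ : Equiv.Perm α} {x y : α} :
    permOrbit σ x = permOrbit σ y ↔ x ∈ permOrbit σ y := by
  refine ⟨fun h => h ▸ mem_permOrbit_self σ x, ?_⟩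
  rintro ⟨k, rfl⟩
  ext z
  constructor
  · rintro ⟨a, rfl⟩
    exact ⟨a + k, by rw [zpow_add, Equiv.Perm.mul_apply]⟩
  · rintro ⟨a, rfl⟩
    exact ⟨a - k, by rw [← Equiv.Perm.mul_apply, ← zpow_add, sub_add_cancel]⟩

theorem card_filter_fst {ι V : Type*} [Fintype ι] [Fintype V] (P : ι → Prop) [DecidablePred P] :
    (Finset.univ.filter fun y : ι × V => P y.1).card
      = Fintype.card V * (Finset.univ.filter P).card := by
  have h : (Finset.univ.filter fun y : ι × V => P y.1)
      = Finset.univ.filter P ×ˢ (Finset.univ : Finset V) := by ext; simp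
  rw [h, Finset.card_product, Finset.card_univ, mul_comm]

section FibrewiseTranslation

variable {ι V : Type*} [AddCommGroup V] {v : ι → V} {τ : Equiv.Perm (ι × V)}

theorem zpow_apply_of_translation (hτ : ∀ i x, τ (i, x) = (i, x + v i)) (k : ℤ) (i : ι) (x : V) :
    (τ ^ k) (i, x) = (i, x + k • v i) := by
  induction k generalizing x with
  | zero => simp
  | succ k ih => rw [zpow_add_one, Equiv.Perm.mul_apply, hτ, ih, add_zsmul, one_zsmul]; abel_nf
  | pred k ih =>
    have hinv : τ⁻¹ (i, x) = (i, x - v i) := by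
      rw [Equiv.Perm.inv_eq_iff_eq, hτ, sub_add_cancel]
    rw [zpow_sub_one, Equiv.Perm.mul_apply, hinv, ih, sub_zsmul, one_zsmul]
    abel_nf

theorem permOrbit_eq_image_of_translation (hτ : ∀ i x, τ (i, x) = (i, x + v i)) (y : ι × V) :
    permOrbit τ y = (fun w => (y.1, y.2 + w)) '' (AddSubgroup.zmultiples (v y.1) : Set V) := by
  obtain ⟨i, x⟩ := y
  ext z
  simp only [permOrbit, Set.mem_ofPred_eq, zpow_apply_of_translation hτ, Set.mem_image,
    SetLike.mem_coe, AddSubgroup.mem_zmultiples_iff, exists_exists_eq_and]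

theorem ncard_permOrbit_of_translation (hτ : ∀ i x, τ (i, x) = (i, x + v i)) (y : ι × V) :
    (permOrbit τ y).ncard = addOrderOf (v y.1) := by
  rw [permOrbit_eq_image_of_translation hτ,
    Set.ncard_image_of_injective _ fun a b h => by simpa using h,
    ← Nat.card_zmultiples]
  rfl

theorem ncard_permOrbit_eq_one (hτ : ∀ i x, τ (i, x) = (i, x + v i)) {y : ι × V}
    (hy : v y.1 = 0) : (permOrbit τ y).ncard = 1 := by
  rw [ncard_permOrbit_of_translation hτ, hy, addOrderOf_zero]

theorem ncard_permOrbit_eq_prime {p : ℕ} (hp : p.Prime) (hV : ∀ w : V, p • w = 0)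
    (hτ : ∀ i x, τ (i, x) = (i, x + v i)) {y : ι × V} (hy : v y.1 ≠ 0) :
    (permOrbit τ y).ncard = p := by
  have := Fact.mk hp
  rw [ncard_permOrbit_of_translation hτ, addOrderOf_eq_prime (hV _) hy]

theorem card_fixedPoints_of_translation [Fintype ι] [Fintype V] [DecidableEq V]
    (hτ : ∀ i x, τ (i, x) = (i, x + v i)) :
    Nat.card {y : ι × V // τ y = y}
      = Fintype.card V * (Finset.univ.filter fun i => v i = 0).card := by
  classical
  rw [← card_filter_fst, Nat.card_eq_fintype_card, Fintype.card_subtype]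
  congr 1
  ext ⟨i, x⟩
  simp [hτ]

theorem ncard_permOrbits_mul_prime [Fintype ι] [Fintype V] [DecidableEq V] {p : ℕ}
    (hp : p.Prime) (hV : ∀ w : V, p • w = 0) (hτ : ∀ i x, τ (i, x) = (i, x + v i)) :
    Set.ncard {s : Set (ι × V) | s ∈ Set.range (permOrbit τ) ∧ s.ncard = p} * p
      = Fintype.card V * (Finset.univ.filter fun i => v i ≠ 0).card := by
  classical
  set A := Finset.univ.filter fun y : ι × V => v y.1 ≠ 0 with hA
  have hmem (y : ι × V) : y ∈ A ↔ (permOrbit τ y).ncard = p := by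
    by_cases hy : v y.1 = 0
    · simp [hA, hy, ncard_permOrbit_eq_one hτ hy, hp.one_lt.ne]
    · simp [hA, hy, ncard_permOrbit_eq_prime hp hV hτ hy]
  have hS : {s : Set (ι × V) | s ∈ Set.range (permOrbit τ) ∧ s.ncard = p}
      = (A.image (permOrbit τ) : Finset (Set (ι × V))) := by
    ext s
    simp only [Set.mem_ofPred_eq, Finset.coe_image, Set.mem_image, Finset.mem_coe, hmem]
    constructor
    · rintro ⟨⟨y, rfl⟩, h⟩
      exact ⟨y, h, rfl⟩
    · rintro ⟨y, h, rfl⟩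
      exact ⟨⟨y, rfl⟩, h⟩
  rw [hS, Set.ncard_coe_finset, ← card_filter_fst, Finset.card_eq_sum_card_image (permOrbit τ),
    Finset.sum_const_nat]
  intro s hs
  obtain ⟨y, hy, rfl⟩ := Finset.mem_image.mp hs
  rw [← (hmem y).mp hy, ← Set.ncard_coe_finset]
  congr 1
  ext z
  simp only [Finset.coe_filter, Set.mem_ofPred_eq, ← permOrbit_eq_iff]
  exact ⟨And.right, fun h => ⟨(hmem z).mpr (h ▸ (hmem y).mp hy), h⟩⟩

end FibrewiseTranslation

/-- Content of the Main Theorem (Theorem 4.2): cycle structure of the product permutation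
attached to a tuple of elements `m_k` of the `ℓ`-fold joint codes `Π_k^ℓ`, and the resulting
identification of the substituted cycle-index monomial with the `(ℓ,r)`-fold joint weight
enumerator monomial. -/
theorem main_theorem_cycle_structure (p m n ℓ r : ℕ) (hp : p.Prime) (hm : 1 ≤ m)
    (F : Type) [Field F] [Fintype F] [DecidableEq F] (hF : Fintype.card F = p ^ m)
    (C : Fin r → Fin ℓ → Submodule F (Fin n → F))
    (M : Fin r → Fin ℓ → Fin n → F)
    (hM : ∀ k j, M k j ∈ C k j)
    (τ : Equiv.Perm (Fin n × (Fin ℓ → F)))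
    (hτ : ∀ i x, τ (i, x) = (i, x + fun j => ∑ k, M k j i))
    (wt : ℕ)
    (hwt : wt = (Finset.univ.filter fun i => (fun j => ∑ k, M k j i) ≠ 0).card) :
    -- (a) the number of fixed points of τ is q^ℓ·(n − wt)
    Nat.card {y : Fin n × (Fin ℓ → F) // τ y = y} = (p ^ m) ^ ℓ * (n - wt) ∧
    -- (b) every orbit of τ has cardinality 1 or p
    (∀ y : Fin n × (Fin ℓ → F), (permOrbit τ y).ncard = 1 ∨ (permOrbit τ y).ncard = p) ∧
    -- (c) the number of orbits of τ of cardinality p is (q^ℓ/p)·wt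
    Set.ncard {s : Set (Fin n × (Fin ℓ → F)) | s ∈ Set.range (permOrbit τ) ∧ s.ncard = p}
      = ((p ^ m) ^ ℓ / p) * wt ∧
    -- the substituted monomial is the (ℓ,r)-fold joint weight enumerator monomial
    (∀ x : (Fin r → Fin ℓ → F) → ℂ,
      (∏ i ∈ Finset.univ.filter fun i => (fun j => ∑ k, M k j i) = 0,
          x fun k j => M k j i) *
      (∏ i ∈ Finset.univ.filter fun i => (fun j => ∑ k, M k j i) ≠ 0,
          x fun k j => M k j i) =
      ∏ i, x fun k j => M k j i) := by
  have := Fact.mk hp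
  set v : Fin n → Fin ℓ → F := fun i j => ∑ k, M k j i
  change ∀ i x, τ (i, x) = (i, x + v i) at hτ
  have hcharF : CharP F p := charP_of_card_eq_prime_pow hF
  have hV (w : Fin ℓ → F) : p • w = 0 := by
    ext j
    simp
  have hcard : Fintype.card (Fin ℓ → F) = (p ^ m) ^ ℓ := by simp [hF]
  change wt = (Finset.univ.filter fun i => v i ≠ 0).card at hwt
  refine ⟨?_, fun y => ?_, ?_, fun x => Finset.prod_filter_mul_prod_filter_not _ _ _⟩
  · rw [card_fixedPoints_of_translation hτ, hcard]
    have h := Finset.card_filter_add_card_filter_not (s := Finset.univ) fun i => v i = 0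
    rw [Finset.card_univ, Fintype.card_fin] at h
    exact congrArg _ (Nat.eq_sub_of_add_eq (by rwa [hwt]))
  · by_cases hy : v y.1 = 0
    · exact .inl (ncard_permOrbit_eq_one hτ hy)
    · exact .inr (ncard_permOrbit_eq_prime hp hV hτ hy)
  · refine Nat.eq_of_mul_eq_mul_right hp.pos ?_
    rw [ncard_permOrbits_mul_prime hp hV hτ, hcard, ← hwt]
    obtain h0 | hpos := Nat.eq_zero_or_pos wt
    · simp [h0]
    · obtain ⟨i, hi⟩ := Finset.card_pos.mp (hwt ▸ hpos)
      obtain ⟨j, -⟩ := Function.ne_iff.mp (Finset.mem_filter.mp hi).2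
      have hdvd : p ∣ (p ^ m) ^ ℓ :=
        (dvd_pow_self p (by omega)).trans (dvd_pow_self _ j.pos.ne')
      rw [mul_right_comm, Nat.div_mul_cancel hdvd]
end

section
/- (Single-position MacWilliams identity, the sufficient claim in the proof of Theorem 3.2.) Let q be a prime power, χ a nontrivial additive character of F_q into ℂ*, and for k ∈ {1,…,r}, j ∈ {1,…,ℓ} let C_{kj} be F_q-linear codes of length n, with ℓ-fold joint codes Π_k^ℓ := {m : Fin ℓ → Fin n → F_q : m(j) ∈ C_{kj} for all j} and duals (Π_k^ℓ)^⊥ := {m : m(j) ∈ C_{kj}^⊥ for all j}. Fix k ∈ {1,…,r}. Then for every function x : (F_q^{ℓ})^r → ℂ (assigning a complex number to each r-tuple of column vectors), |Π_k^ℓ| · ∑_{m_1 ∈ Π_1^ℓ, …, m_k ∈ (Π_k^ℓ)^⊥, …, m_r ∈ Π_r^ℓ} ∏_{i=1}^{n} x(col_i m_1, …, col_i m_r) = ∑_{m_1 ∈ Π_1^ℓ, …, m_k ∈ Π_k^ℓ, …, m_r ∈ Π_r^ℓ} ∏_{i=1}^{n} ( ∑_{v ∈ F_q^ℓ} χ((col_i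 m_k) · v) · x(col_i m_1, …, col_{i}m_{k-1}, v, col_i m_{k+1}, …, col_i m_r) ), where col_i m denotes the i-th column j ↦ m(j)(i) and a · v := ∑_{j=1}^{ℓ} a_j v_j. -/
/-- Orthogonality relation: a nontrivial additive character composed with a linear functional
sums over a finite vector space to its cardinality if the functional vanishes, and to zero
otherwise. -/
theorem AddChar.sum_linearMap_eq_ite {F W : Type*} [Field F] [AddCommGroup W] [Module F W]
    [Fintype W] {χ : AddChar F ℂ} (hχ : ∃ a, χ a ≠ 1) (φ : W →ₗ[F] F) [Decidable (φ = 0)] :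
    ∑ u, χ (φ u) = if φ = 0 then (Nat.card W : ℂ) else 0 := by
  classical
  have h0 : χ.compAddMonoidHom φ.toAddMonoidHom = 0 ↔ φ = 0 := by
    refine ⟨fun h => ?_, fun h => by ext u; simp [h]⟩
    obtain ⟨a, ha⟩ := hχ
    ext u
    by_contra hu
    have := DFunLike.congr_fun h ((a / φ u) • u)
    simp only [AddChar.compAddMonoidHom_apply, LinearMap.toAddMonoidHom_coe, map_smul,
      smul_eq_mul, div_mul_cancel₀ _ (show φ u ≠ 0 from hu), AddChar.zero_apply] at this
    exact ha this
  have := AddChar.sum_eq_ite (χ.compAddMonoidHom φ.toAddMonoidHom)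
  simpa [h0] using this

/-- The character sum over a joint code, tested against a matrix `w`, is the size of the joint
code or zero according to whether every row of `w` lies in the corresponding dual code. -/
theorem sum_jointCode_addChar {F ι κ : Type*} [Field F] [Fintype F] [Fintype ι] [Fintype κ]
    {χ : AddChar F ℂ} (hχ : ∃ a, χ a ≠ 1) (C : κ → Submodule F (ι → F)) (w : κ → ι → F)
    [DecidablePred fun u : κ → ι → F => ∀ j, u j ∈ C j]
    [Decidable (∀ j, ∀ u ∈ C j, ∑ i, u i * w j i = 0)] [DecidableEq κ] [DecidableEq ι] :
    ∑ u : κ → ι → F, (if ∀ j, u j ∈ C j then χ (∑ i, ∑ j, u j i * w j i) else 0) =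
      if ∀ j, ∀ u ∈ C j, ∑ i, u i * w j i = 0 then
        (Nat.card {u : κ → ι → F // ∀ j, u j ∈ C j} : ℂ) else 0 := by
  classical
  let W : Submodule F (κ → ι → F) := Submodule.pi Set.univ C
  have hW (u : κ → ι → F) : u ∈ W ↔ ∀ j, u j ∈ C j := by simp [W, Submodule.mem_pi]
  let φ : W →ₗ[F] F :=
    { toFun := fun u => ∑ i, ∑ j, u.1 j i * w j i
      map_add' := fun u v => by simp [add_mul, Finset.sum_add_distrib]
      map_smul' := fun c u => by simp [mul_assoc, Finset.mul_sum] }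
  have hφ : φ = 0 ↔ ∀ j, ∀ u ∈ C j, ∑ i, u i * w j i = 0 := by
    constructor
    · intro h j u hu
      have hs : Pi.single j u ∈ W := by
        rw [hW]
        intro j'
        obtain rfl | hj := eq_or_ne j' j
        · simpa using hu
        · simp [Pi.single_eq_of_ne hj]
      have := LinearMap.congr_fun h ⟨_, hs⟩
      change ∑ i, ∑ j', (Pi.single j u : κ → ι → F) j' i * w j' i = 0 at this
      rw [Finset.sum_comm, Finset.sum_eq_single j] at this
      · simpa using this
      · intro j' _ hj
        simp [Pi.single_eq_of_ne hj]
      · simp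
    · intro h
      ext u
      change ∑ i, ∑ j, u.1 j i * w j i = 0
      rw [Finset.sum_comm]
      exact Finset.sum_eq_zero fun j _ => h j _ ((hW _).1 u.2 j)
  have hcard : Nat.card W = Nat.card {u : κ → ι → F // ∀ j, u j ∈ C j} :=
    Nat.card_congr (Equiv.subtypeEquivRight hW)
  have key := AddChar.sum_linearMap_eq_ite hχ φ
  simp only [hφ, hcard] at key
  rw [← key, ← Finset.sum_filter]
  exact Finset.sum_subtype _ (fun u => by simp [hW]) _

/-- Exchanging an entry of a family with a separate value is an involution. -/
theorem Function.Involutive.update_swap {α β : Type*} [DecidableEq α] (k : α) :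
    Function.Involutive fun p : (α → β) × β => (Function.update p.1 k p.2, p.1 k) := by
  rintro ⟨f, b⟩
  simp


/-- Single-position MacWilliams identity for `(ℓ,r)`-fold complete joint weight enumerators
(the sufficient claim in the proof of Theorem 3.2): dualizing the `k`-th joint code
corresponds to applying the character-sum transform at position `k`. -/
theorem single_position_macwilliams (q n ℓ r : ℕ) (hq : IsPrimePow q)
    (F : Type) [Field F] [Fintype F] [DecidableEq F] (hF : Fintype.card F = q)
    (χ : AddChar F ℂ) (hχ : ∃ a, χ a ≠ 1)
    (C : Fin r → Fin ℓ → Submodule F (Fin n → F))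
    (k : Fin r)
    (x : (Fin r → Fin ℓ → F) → ℂ) :
    ((Nat.card {mm : Fin ℓ → Fin n → F // ∀ j, mm j ∈ C k j} : ℂ) *
      ∑ᶠ M ∈ {M : Fin r → Fin ℓ → Fin n → F |
          (∀ j, ∀ u ∈ C k j, ∑ i, u i * M k j i = 0) ∧
          ∀ k', k' ≠ k → ∀ j, M k' j ∈ C k' j},
        ∏ i, x fun k' j => M k' j i)
    =
    (∑ᶠ M ∈ {M : Fin r → Fin ℓ → Fin n → F | ∀ k' j, M k' j ∈ C k' j},
      ∏ i, ∑ v : Fin ℓ → F,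
        χ (∑ j, M k j i * v j) * x (Function.update (fun k' j => M k' j i) k v)) := by
  classical
  let f : (Fin r → Fin ℓ → Fin n → F) → ℂ := fun M => ∏ i, x fun k' j => M k' j i
  have hsum (g : Fin n → F) : χ (∑ i, g i) = ∏ i, χ (g i) :=
    map_prod χ.toMonoidHom (fun i => Multiplicative.ofAdd (g i)) Finset.univ
  have expand (M : Fin r → Fin ℓ → Fin n → F) :
      ∏ i, ∑ v : Fin ℓ → F,
        χ (∑ j, M k j i * v j) * x (Function.update (fun k' j => M k' j i) k v) =
      ∑ w : Fin ℓ → Fin n → F,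
        χ (∑ i, ∑ j, M k j i * w j i) * f (Function.update M k w) := by
    rw [Fintype.prod_sum]
    refine Fintype.sum_equiv (Equiv.piComm fun _ _ => F) _ _ fun w => ?_
    rw [Finset.prod_mul_distrib, hsum]
    congr 1
    refine Finset.prod_congr rfl fun i _ => congrArg x ?_
    funext k'
    obtain rfl | h := eq_or_ne k' k
    · simp [Equiv.piComm]
    · simp [h]
  have split (M : Fin r → Fin ℓ → Fin n → F) :
      (∀ k' j, M k' j ∈ C k' j) ↔
        (∀ k', k' ≠ k → ∀ j, M k' j ∈ C k' j) ∧ ∀ j, M k j ∈ C k j := by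
    refine ⟨fun h => ⟨fun k' _ => h k', h k⟩, fun h k' => ?_⟩
    obtain rfl | hk := eq_or_ne k' k
    exacts [h.2, h.1 k' hk]
  simp only [expand]
  rw [finsum_mem_eq_finite_toFinset_sum _ (Set.toFinite _),
    finsum_mem_eq_finite_toFinset_sum _ (Set.toFinite _)]
  simp only [Set.Finite.toFinset_ofPred, Finset.sum_filter]
  symm
  calc
    _ = ∑ p : (Fin r → Fin ℓ → Fin n → F) × (Fin ℓ → Fin n → F),
          if ∀ k' j, p.1 k' j ∈ C k' j then
            χ (∑ i, ∑ j, p.1 k j i * p.2 j i) * f (Function.update p.1 k p.2) else 0 := by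
      rw [Fintype.sum_prod_type]
      exact Finset.sum_congr rfl fun M _ => by split_ifs <;> simp
    _ = ∑ p : (Fin r → Fin ℓ → Fin n → F) × (Fin ℓ → Fin n → F),
          if ∀ k', k' ≠ k → ∀ j, p.1 k' j ∈ C k' j then
            (if ∀ j, p.2 j ∈ C k j then
              χ (∑ i, ∑ j, p.2 j i * p.1 k j i) else 0) * f p.1 else 0 := by
      refine Fintype.sum_equiv (Function.Involutive.update_swap k).toPerm _ _ ?_
      rintro ⟨M, w⟩
      have h : (∀ k', k' ≠ k → ∀ j, Function.update M k w k' j ∈ C k' j) ↔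
          ∀ k', k' ≠ k → ∀ j, M k' j ∈ C k' j :=
        forall₂_congr fun k' hk => by rw [Function.update_of_ne hk]
      simp only [Function.Involutive.coe_toPerm, h, split M, Function.update_self, ite_and,
        ite_mul, zero_mul]
    _ = _ := by
      rw [Fintype.sum_prod_type, Finset.mul_sum]
      refine Finset.sum_congr rfl fun M _ => ?_
      by_cases h : ∀ k', k' ≠ k → ∀ j, M k' j ∈ C k' j
      · simp only [if_pos h, ← Finset.sum_mul]
        rw [sum_jointCode_addChar hχ (C k) (M k)]
        simp only [and_iff_left h, ite_mul, mul_ite, zero_mul, mul_zero, f]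
      · simp only [if_neg h, Finset.sum_const_zero, mul_zero,
          if_neg fun h' => h (And.right h')]
end

section
/- (Theorem 3.2: MacWilliams identity for (ℓ,r)-fold complete joint weight enumerators.) Let q be a prime power, χ a nontrivial additive character of F_q into ℂ*, and for k ∈ {1,…,r}, j ∈ {1,…,ℓ} let C_{kj} be F_q-linear codes of length n, with ℓ-fold joint codes Π_k^ℓ := {m : Fin ℓ → Fin n → F_q : m(j) ∈ C_{kj} for all j} and duals (Π_k^ℓ)^⊥ := {m : m(j) ∈ C_{kj}^⊥ for all j}. Let S ⊆ {1,…,r} be the set of dualized positions, and set Π̂_k := (Π_k^ℓ)^⊥ if k ∈ S and Π̂_k := Π_k^ℓ otherwise. Then for every x : (F_q^{ℓ})^r → ℂ, ∑_{m_1 ∈ Π̂_1, …, m_r ∈ Π̂_r} ∏_{i=1}^{n} x(col_i m_1, …, col_i m_r) = (1/∏_{k∈S} |Π_k^ℓ|) · ∑_{m_1 ∈ Π_1^ℓ, …, m_r ∈ Π_r^ℓ} ∏_{i=1}^{n} ( ∑_{(v_k)_{k∈S}, v_k ∈ F_q^ℓ} (∏_{k∈S} χ((col_i m_k) · v_k))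 · x(b_1, …, b_r) ), where b_k := v_k for k ∈ S and b_k := col_i m_k for k ∉ S, col_i m is the i-th column j ↦ m(j)(i), and a · v := ∑_{j=1}^{ℓ} a_j v_j. -/
/-- The character sum over a linear code is the size of the code on its dual, and zero elsewhere. -/
theorem sum_addChar_dotProduct_submodule {F ι : Type*} [Field F] [Fintype F] [Fintype ι]
    (χ : AddChar F ℂ) (hχ : ∃ a, χ a ≠ 1) (C : Submodule F (ι → F)) [Fintype C] (v : ι → F)
    [Decidable (∀ u ∈ C, ∑ i, u i * v i = 0)] :
    ∑ u : C, χ (∑ i, u.1 i * v i) =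
      if ∀ u ∈ C, ∑ i, u i * v i = 0 then (Nat.card C : ℂ) else 0 := by
  split_ifs with h
  · simp [fun u : C => h u.1 u.2]
  · push Not at h
    obtain ⟨u, hu, hne⟩ := h
    obtain ⟨a, ha⟩ := hχ
    let ψ : AddChar C ℂ :=
      { toFun := fun u => χ (∑ i, u.1 i * v i)
        map_zero_eq_one' := by simp
        map_add_eq_mul' := fun a b => by
          simp [add_mul, Finset.sum_add_distrib, AddChar.map_add_eq_mul] }
    refine AddChar.sum_eq_zero_of_ne_one (ψ := ψ) fun hψ => ha ?_
    have := DFunLike.congr_fun hψ ⟨(a / ∑ i, u i * v i) • u, C.smul_mem _ hu⟩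
    change χ (∑ i, (a / ∑ i, u i * v i) * u i * v i) = 1 at this
    simp_rw [mul_assoc] at this
    rwa [← Finset.mul_sum, div_mul_cancel₀ _ hne] at this

/-- The kernel of the coordinate transform that is the character transform when `p` holds and the
identity otherwise. -/
def partialCharKernel {F : Type*} [Field F] [DecidableEq F] (χ : AddChar F ℂ)
    (p : Prop) [Decidable p] (a b : F) : ℂ :=
  if p then χ (a * b) else if a = b then 1 else 0

theorem prod_partialCharKernel {F ι : Type*} [Field F] [DecidableEq F] [Fintype ι]
    (χ : AddChar F ℂ) (p : Prop) [Decidable p] (u v : ι → F) :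
    ∏ i, partialCharKernel χ p (u i) (v i) =
      if p then χ (∑ i, u i * v i) else if u = v then 1 else 0 := by
  unfold partialCharKernel
  split_ifs with hp h
  · exact (map_prod χ.toMonoidHom (fun i => Multiplicative.ofAdd (u i * v i)) _).symm
  · simp [h]
  · obtain ⟨i, hi⟩ := Function.ne_iff.1 h
    exact Finset.prod_eq_zero (Finset.mem_univ i) (if_neg hi)

open Classical in
theorem sum_prod_partialCharKernel {F ι : Type*} [Field F] [Fintype F] [DecidableEq F]
    [Fintype ι] (χ : AddChar F ℂ) (hχ : ∃ a, χ a ≠ 1) (p : Prop) [Decidable p]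
    (C : Submodule F (ι → F)) [Fintype C] (v : ι → F) :
    ∑ u : C, ∏ i, partialCharKernel χ p (u.1 i) (v i) =
      (if p then (Nat.card C : ℂ) else 1) *
        if (p → ∀ u ∈ C, ∑ i, u i * v i = 0) ∧ (¬ p → v ∈ C) then 1 else 0 := by
  simp_rw [prod_partialCharKernel]
  by_cases hp : p
  · simp [hp, sum_addChar_dotProduct_submodule χ hχ]
  · by_cases hv : v ∈ C
    · rw [Finset.sum_eq_single ⟨v, hv⟩] <;> simp_all [Subtype.ext_iff]
    · have (u : C) : u.1 ≠ v := fun h => hv (h ▸ u.2)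
      simp [hp, hv, this]

theorem prod_prod_ite_one_zero {κ ι R : Type*} [Fintype κ] [Fintype ι] [CommMonoidWithZero R]
    {p : κ → ι → Prop} {_ : ∀ k j, Decidable (p k j)} {P : Prop} {_ : Decidable P}
    (h : (∀ k j, p k j) ↔ P) :
    ∏ k, ∏ j, (if p k j then 1 else 0 : R) = if P then 1 else 0 := by
  classical
  simp_rw [Fintype.prod_boole, h]

/-- A transform in the variables indexed by `S`, written as a full sum with the kernel that is
trivial outside `S`. -/
theorem sum_prod_addChar_eq_sum_partialCharKernel {F κ ι : Type*} [Field F] [Fintype F]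
    [DecidableEq F] [Fintype κ] [DecidableEq κ] [Fintype ι] [DecidableEq ι]
    (χ : AddChar F ℂ) (S : Finset κ)
    (x : (κ → ι → F) → ℂ) (a : κ → ι → F) :
    ∑ v : {k // k ∈ S} → ι → F,
        (∏ k : {k // k ∈ S}, χ (∑ j, a k.1 j * v k j)) *
          x (fun k j => if h : k ∈ S then v ⟨k, h⟩ j else a k j) =
      ∑ b : κ → ι → F, (∏ k, ∏ j, partialCharKernel χ (k ∈ S) (a k j) (b k j)) * x b := by
  simp_rw [prod_partialCharKernel]
  refine Fintype.sum_of_injective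
    (fun v k j => if h : k ∈ S then v ⟨k, h⟩ j else a k j) ?_ _ _ ?_ ?_
  · intro v w h
    ext k j
    simpa using congrFun (congrFun h k.1) j
  · intro b hb
    obtain ⟨k, hk, hne⟩ : ∃ k, k ∉ S ∧ a k ≠ b k := by
      by_contra! h
      refine hb ⟨fun k => b k.1, ?_⟩
      ext k j
      by_cases hk : k ∈ S
      · simp [hk]
      · simp [hk, h k hk]
    rw [Finset.prod_eq_zero (Finset.mem_univ k) (by simp [hk, hne]), zero_mul]
  · intro v
    congr 1
    rw [← Finset.prod_subset (Finset.subset_univ S), ← Finset.prod_coe_sort S]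
    · refine Finset.prod_congr rfl fun k _ => ?_
      simp
    · intro k _ hk
      simp [hk]


/-- Theorem 3.2: the MacWilliams identity for `(ℓ,r)`-fold complete joint weight enumerators.
The joint weight enumerator of the joint codes with the positions in `S` dualized equals
`1/∏_{k ∈ S} |Π_k^ℓ|` times the joint weight enumerator of the original joint codes with the
variables at the positions in `S` transformed by the character sums. -/
theorem macwilliams_joint_weight_enumerator (q n ℓ r : ℕ) (hq : IsPrimePow q)
    (F : Type) [Field F] [Fintype F] [DecidableEq F] (hF : Fintype.card F = q)
    (χ : AddChar F ℂ) (hχ : ∃ a, χ a ≠ 1)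
    (C : Fin r → Fin ℓ → Submodule F (Fin n → F))
    (S : Finset (Fin r))
    (x : (Fin r → Fin ℓ → F) → ℂ) :
    (∑ᶠ M ∈ {M : Fin r → Fin ℓ → Fin n → F |
        ∀ k, (k ∈ S → ∀ j, ∀ u ∈ C k j, ∑ i, u i * M k j i = 0) ∧
             (k ∉ S → ∀ j, M k j ∈ C k j)},
      ∏ i, x fun k j => M k j i)
    =
    (∏ k ∈ S, (Nat.card {mm : Fin ℓ → Fin n → F // ∀ j, mm j ∈ C k j} : ℂ))⁻¹ *
    (∑ᶠ M ∈ {M : Fin r → Fin ℓ → Fin n → F | ∀ k j, M k j ∈ C k j},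
      ∏ i, ∑ v : {k // k ∈ S} → Fin ℓ → F,
        (∏ k : {k // k ∈ S}, χ (∑ j, M k.1 j i * v k j)) *
          x fun k j => if h : k ∈ S then v ⟨k, h⟩ j else M k j i) := by
  classical
  set K : Fin r → Fin ℓ → (Fin n → F) → (Fin n → F) → ℂ :=
    fun k j u w => ∏ i, partialCharKernel χ (k ∈ S) (u i) (w i) with hK
  have expand (M : Fin r → Fin ℓ → Fin n → F) :
      (∏ i, ∑ v : {k // k ∈ S} → Fin ℓ → F,
        (∏ k : {k // k ∈ S}, χ (∑ j, M k.1 j i * v k j)) *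
          x fun k j => if h : k ∈ S then v ⟨k, h⟩ j else M k j i) =
      ∑ N : Fin r → Fin ℓ → Fin n → F,
        (∏ k, ∏ j, K k j (M k j) (N k j)) * ∏ i, x fun k j => N k j i := by
    rw [Finset.prod_congr rfl fun i _ =>
      sum_prod_addChar_eq_sum_partialCharKernel χ S x (fun k j => M k j i)]
    rw [Fintype.prod_sum]
    let e : (Fin n → Fin r → Fin ℓ → F) ≃ (Fin r → Fin ℓ → Fin n → F) :=
      ⟨fun B k j i => B i k j, fun N i k j => N k j i, fun _ => rfl, fun _ => rfl⟩
    refine Fintype.sum_equiv e _ _ fun B => ?_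
    rw [Finset.prod_mul_distrib, Finset.prod_comm]
    congr 1
    exact Finset.prod_congr rfl fun k _ => Finset.prod_comm
  let eC : {M : Fin r → Fin ℓ → Fin n → F // ∀ k j, M k j ∈ C k j} ≃ (∀ k j, C k j) :=
    ⟨fun M k j => ⟨M.1 k j, M.2 k j⟩, fun M => ⟨fun k j => (M k j).1, fun k j => (M k j).2⟩,
      fun _ => rfl, fun _ => rfl⟩
  have factor (N : Fin r → Fin ℓ → Fin n → F) :
      ∑ M : (∀ k j, C k j), ∏ k, ∏ j, K k j (M k j) (N k j) =
        ∏ k, ∏ j, ∑ u : C k j, K k j u (N k j) := by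
    simp_rw [Fintype.prod_sum]
  have hcard (k : Fin r) : (Nat.card {mm : Fin ℓ → Fin n → F // ∀ j, mm j ∈ C k j} : ℂ) =
      ∏ j, (Nat.card (C k j) : ℂ) := by
    rw [Nat.card_congr (Equiv.subtypePiEquivPi (p := fun j m => m ∈ C k j)), Nat.card_pi]
    push_cast
    rfl
  have inner (N : Fin r → Fin ℓ → Fin n → F) :
      ∏ k, ∏ j, ∑ u : C k j, K k j u (N k j) =
        (∏ k ∈ S, (Nat.card {mm : Fin ℓ → Fin n → F // ∀ j, mm j ∈ C k j} : ℂ)) *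
        if ∀ k, (k ∈ S → ∀ j, ∀ u ∈ C k j, ∑ i, u i * N k j i = 0) ∧
             (k ∉ S → ∀ j, N k j ∈ C k j) then 1 else 0 := by
    simp_rw [hK, sum_prod_partialCharKernel χ hχ, Finset.prod_mul_distrib]
    congr 1
    · rw [← Finset.prod_subset (Finset.subset_univ S)]
      · exact Finset.prod_congr rfl fun k hk => by rw [hcard]; simp [hk]
      · intro k _ hk
        simp [hk]
    · refine prod_prod_ite_one_zero ?_
      exact forall_congr' fun k => by by_cases hk : k ∈ S <;> simp [hk]
  have hne : (∏ k ∈ S, (Nat.card {mm : Fin ℓ → Fin n → F // ∀ j, mm j ∈ C k j} : ℂ)) ≠ 0 := by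
    simp_rw [hcard]
    exact Finset.prod_ne_zero_iff.2 fun k _ => Finset.prod_ne_zero_iff.2 fun j _ =>
      Nat.cast_ne_zero.2 Nat.card_pos.ne'
  rw [eq_inv_mul_iff_mul_eq₀ hne]
  rw [finsum_mem_congr rfl fun M _ => expand M,
    finsum_mem_eq_finite_toFinset_sum _ (Set.toFinite _),
    ← finsum_set_coe_eq_finsum_mem, finsum_eq_sum_of_fintype, Finset.sum_comm, Finset.mul_sum]
  simp_rw [← Finset.sum_mul]
  rw [Set.Finite.toFinset_ofPred, Finset.sum_filter]
  refine Finset.sum_congr rfl fun N _ => ?_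
  have hsum : ∑ M : {M : Fin r → Fin ℓ → Fin n → F // ∀ k j, M k j ∈ C k j},
      ∏ k, ∏ j, K k j (M.1 k j) (N k j) =
        ∑ M : (∀ k j, C k j), ∏ k, ∏ j, K k j (M k j) (N k j) :=
    Fintype.sum_equiv eC _ _ fun _ => rfl
  rw [factor, inner] at hsum
  refine Eq.trans ?_ (congrArg (· * ∏ i, x fun k j => N k j i) hsum.symm)
  split_ifs <;> ring
end

section
/- (Theorem 6.2: MacWilliams identity for (ℓ,r)-fold complete joint weight enumerators over ℤ_k.) Let k ≥ 2, let η ∈ ℂ be a primitive k-th root of unity, and for ν ∈ {1,…,r}, j ∈ {1,…,ℓ} let C_{νj} be ℤ_k-linear codes of length n, with ℓ-fold joint codes Π_ν^ℓ := {m : Fin ℓ → Fin n → ZMod k : m(j) ∈ C_{νj} for all j} and duals (Π_ν^ℓ)^⊥ := {m : m(j) ∈ C_{νj}^⊥ for all j}. Let S ⊆ {1,…,r} and set Π̂_ν := (Π_ν^ℓ)^⊥ if ν ∈ S and Π̂_ν := Π_ν^ℓ otherwise. Then for every x : ((ZMod k)^ℓ)^r → ℂ, ∑_{m_1 ∈ Π̂_1,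 …, m_r ∈ Π̂_r} ∏_{i=1}^{n} x(col_i m_1, …, col_i m_r) = (1/∏_{ν∈S} |Π_ν^ℓ|) · ∑_{m_1 ∈ Π_1^ℓ, …, m_r ∈ Π_r^ℓ} ∏_{i=1}^{n} ( ∑_{(v_ν)_{ν∈S}, v_ν ∈ (ZMod k)^ℓ} (∏_{ν∈S} η^{((col_i m_ν) · v_ν).val}) · x(b_1, …, b_r) ), where b_ν := v_ν for ν ∈ S and b_ν := col_i m_ν otherwise, col_i m is the i-th column j ↦ m(j)(i), a · v := ∑_{j=1}^{ℓ} a_j v_j ∈ ZMod k, and (c).val is the representative of c in {0,…,k−1}. -/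
open Finset

section JointWeightEnumerator

theorem finsum_mem_pi_pi {ι κ α : Type*} [Fintype ι] [Fintype κ] [DecidableEq ι]
    [DecidableEq κ] (D : ι → κ → Finset α)
    (s : Set (ι → κ → α)) (hs : ∀ M, M ∈ s ↔ ∀ a b, M a b ∈ D a b) (f : (ι → κ → α) → ℂ) :
    ∑ᶠ M ∈ s, f M = ∑ M ∈ Fintype.piFinset fun a => Fintype.piFinset (D a), f M := by
  have h : s = ↑(Fintype.piFinset fun a => Fintype.piFinset (D a)) := by
    ext M
    simp [hs]
  rw [h, finsum_mem_coe_finset]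

/-- The kernel of the variable transformation: a character of the product `a * b` at a dualized
position, the identity matrix at every other position. -/
noncomputable def positionKernel {R : Type*} [Mul R] [DecidableEq R] (χ : R → ℂ) (p : Prop)
    [Decidable p] (a b : R) : ℂ :=
  if p then χ (a * b) else if b = a then 1 else 0

theorem addChar_sum_eq_prod {A ι : Type*} [AddCommMonoid A] (χ : AddChar A ℂ) (s : Finset ι)
    (f : ι → A) : χ (∑ i ∈ s, f i) = ∏ i ∈ s, χ (f i) :=
  map_prod χ.toMonoidHom (fun i => Multiplicative.ofAdd (f i)) s

theorem sum_pi_pi_prod_prod {ι κ α : Type*} [Fintype ι] [Fintype κ] [DecidableEq ι]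
    [DecidableEq κ] (D : ι → κ → Finset α) (f : ι → κ → α → ℂ) :
    ∑ M ∈ Fintype.piFinset fun a => Fintype.piFinset (D a), ∏ a, ∏ b, f a b (M a b) =
      ∏ a, ∏ b, ∑ m ∈ D a b, f a b m := by
  simp only [prod_univ_sum]

/-- Expands a product, over the columns, of sums over the values of a column. -/
theorem prod_sum_columns {ι κ γ α : Type*} [Fintype ι] [Fintype κ] [Fintype γ] [Fintype α]
    [DecidableEq ι] [DecidableEq κ] [DecidableEq γ] (f : γ → (ι → κ → α) → ℂ) :
    ∏ i, ∑ w, f i w = ∑ W : ι → κ → γ → α, ∏ i, f i fun a b => W a b i := by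
  rw [prod_univ_sum, Fintype.piFinset_univ]
  exact Fintype.sum_equiv
    ⟨fun V a b i => V i a b, fun W i a b => W a b i, fun _ => rfl, fun _ => rfl⟩ _ _
    fun _ => rfl

open scoped Classical in
theorem sum_submodule_addChar {k n : ℕ} [NeZero k] {η : ℂ} (hη : IsPrimitiveRoot η k)
    (C : Submodule (ZMod k) (Fin n → ZMod k)) (w : Fin n → ZMod k) :
    ∑ m with m ∈ C, ∏ i, AddChar.zmodChar k hη.pow_eq_one (m i * w i) =
      if ∀ u ∈ C, ∑ i, u i * w i = 0 then (Nat.card C : ℂ) else 0 := by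
  set χ := AddChar.zmodChar k hη.pow_eq_one with hχ
  let L : C →+ ZMod k :=
    { toFun := fun u => ∑ i, u.1 i * w i
      map_zero' := by simp
      map_add' := fun u v => by simp [add_mul, sum_add_distrib] }
  have h1 : ∑ m with m ∈ C, ∏ i, χ (m i * w i) = ∑ u : C, χ.compAddMonoidHom L u := by
    rw [Finset.sum_subtype (p := (· ∈ C)) (univ.filter (· ∈ C)) (by simp)]
    refine sum_congr rfl fun m _ => ?_
    rw [← addChar_sum_eq_prod]
    rfl
  have h2 : χ.compAddMonoidHom L = 0 ↔ ∀ u ∈ C, ∑ i, u i * w i = 0 := by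
    rw [DFunLike.ext_iff]
    constructor
    · intro h u hu
      have h3 : χ (∑ i, u i * w i) = 1 := h ⟨u, hu⟩
      rw [hχ, AddChar.zmodChar_apply, hη.pow_eq_one_iff_dvd] at h3
      exact (ZMod.val_eq_zero _).1 (Nat.eq_zero_of_dvd_of_lt h3 (ZMod.val_lt _))
    · intro h u
      change χ (∑ i, u.1 i * w i) = 1
      rw [h u u.2, AddChar.map_zero_eq_one]
  rw [h1, AddChar.sum_eq_ite, Nat.card_eq_fintype_card]
  simp only [h2]

open scoped Classical in
theorem sum_positionKernel {k n : ℕ} [NeZero k] {η : ℂ} (hη : IsPrimitiveRoot η k)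
    (C : Submodule (ZMod k) (Fin n → ZMod k)) (p : Prop) [Decidable p]
    (w : Fin n → ZMod k) :
    ∑ m with m ∈ C, ∏ i, positionKernel (AddChar.zmodChar k hη.pow_eq_one) p (m i) (w i) =
      (if p then (Nat.card C : ℂ) else 1) *
        if (p → ∀ u ∈ C, ∑ i, u i * w i = 0) ∧ (¬p → w ∈ C) then 1 else 0 := by
  by_cases hp : p
  · simp [positionKernel, hp, sum_submodule_addChar hη]
  · have h (m : Fin n → ZMod k) :
        (∏ i, if w i = m i then (1 : ℂ) else 0) = if w = m then 1 else 0 := by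
      rw [prod_ite_zero]
      simp [funext_iff]
    simp [positionKernel, hp, h]

/-- A sum over the variables at the positions in `S` is a sum over all variables, weighted by
the kernels. -/
theorem sum_dualized_eq_sum_positionKernel {R ι κ : Type*} [CommRing R] [Fintype R]
    [DecidableEq R] [Fintype ι] [DecidableEq ι] [Fintype κ] [DecidableEq κ] (χ : AddChar R ℂ)
    (S : Finset ι) (a : ι → κ → R) (x : (ι → κ → R) → ℂ) :
    ∑ v : {ν // ν ∈ S} → κ → R, (∏ ν : {ν // ν ∈ S}, χ (∑ j, a ν.1 j * v ν j)) *
        x (fun ν j => if h : ν ∈ S then v ⟨ν, h⟩ j else a ν j) =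
      ∑ w : ι → κ → R, (∏ ν, ∏ j, positionKernel χ (ν ∈ S) (a ν j) (w ν j)) * x w := by
  refine sum_of_injOn (fun v ν j => if h : ν ∈ S then v ⟨ν, h⟩ j else a ν j) ?_ ?_ ?_ ?_
  · intro v _ v' _ h
    funext ν j
    simpa using congr_fun (congr_fun h ν) j
  · simp
  · intro w _ hw
    obtain ⟨ν, hν, j, hj⟩ : ∃ ν, ν ∉ S ∧ ∃ j, w ν j ≠ a ν j := by
      by_contra! hcon
      refine hw ⟨fun ν => w ν, by simp, ?_⟩
      funext ν j
      by_cases h : ν ∈ S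
      · simp [h]
      · simp [h, hcon ν h j]
    have h0 : positionKernel χ (ν ∈ S) (a ν j) (w ν j) = 0 := by simp [positionKernel, hν, hj]
    rw [prod_eq_zero (mem_univ ν) (prod_eq_zero (mem_univ j) h0), zero_mul]
  · intro v _
    congr 1
    rw [← prod_subset (subset_univ S), ← prod_coe_sort S]
    · refine prod_congr rfl fun ν _ => ?_
      rw [addChar_sum_eq_prod]
      simp [positionKernel]
    · intro ν _ hν
      simp [positionKernel, hν]

end JointWeightEnumerator


/-- Theorem 6.2: the MacWilliams identity for `(ℓ,r)`-fold complete joint weight enumerators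
over `ℤ_k`.  The joint weight enumerator of the joint codes with the positions in `S`
dualized equals `1/∏_{ν ∈ S} |Π_ν^ℓ|` times the joint weight enumerator of the original
joint codes with the variables at the positions in `S` transformed by the character sums
built from a primitive `k`-th root of unity `η`. -/
theorem macwilliams_joint_weight_enumerator_zmod (k n ℓ r : ℕ) [NeZero k] (hk : 2 ≤ k)
    (η : ℂ) (hη : IsPrimitiveRoot η k)
    (C : Fin r → Fin ℓ → Submodule (ZMod k) (Fin n → ZMod k))
    (S : Finset (Fin r))
    (x : (Fin r → Fin ℓ → ZMod k) → ℂ) :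
    (∑ᶠ M ∈ {M : Fin r → Fin ℓ → Fin n → ZMod k |
        ∀ ν, (ν ∈ S → ∀ j, ∀ u ∈ C ν j, ∑ i, u i * M ν j i = 0) ∧
             (ν ∉ S → ∀ j, M ν j ∈ C ν j)},
      ∏ i, x fun ν j => M ν j i)
    =
    (∏ ν ∈ S, (Nat.card {mm : Fin ℓ → Fin n → ZMod k // ∀ j, mm j ∈ C ν j} : ℂ))⁻¹ *
    (∑ᶠ M ∈ {M : Fin r → Fin ℓ → Fin n → ZMod k | ∀ ν j, M ν j ∈ C ν j},
      ∏ i, ∑ v : {ν // ν ∈ S} → Fin ℓ → ZMod k,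
        (∏ ν : {ν // ν ∈ S}, η ^ (∑ j, M ν.1 j i * v ν j).val) *
          x fun ν j => if h : ν ∈ S then v ⟨ν, h⟩ j else M ν j i) := by
  classical
  set χ := AddChar.zmodChar k hη.pow_eq_one with hχ
  let P (ν : Fin r) (j : Fin ℓ) (w : Fin n → ZMod k) : Prop :=
    (ν ∈ S → ∀ u ∈ C ν j, ∑ i, u i * w i = 0) ∧ (ν ∉ S → w ∈ C ν j)
  have hcard : ∏ ν ∈ S, (Nat.card {mm : Fin ℓ → Fin n → ZMod k // ∀ j, mm j ∈ C ν j} : ℂ) =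
      ∏ ν, ∏ j, if ν ∈ S then (Nat.card (C ν j) : ℂ) else 1 := by
    rw [← prod_subset (subset_univ S)]
    · refine prod_congr rfl fun ν hν => ?_
      rw [Nat.card_congr (Equiv.subtypePiEquivPi (p := fun j m => m ∈ C ν j)), Nat.card_pi]
      simp [hν]
    · intro ν _ hν
      simp [hν]
  have hcard_ne : ∏ ν, ∏ j, (if ν ∈ S then (Nat.card (C ν j) : ℂ) else 1) ≠ 0 := by
    refine prod_ne_zero_iff.2 fun ν _ => prod_ne_zero_iff.2 fun j _ => ?_
    split_ifs
    · exact Nat.cast_ne_zero.2 Nat.card_pos.ne'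
    · exact one_ne_zero
  have hdual : (∑ᶠ M ∈ {M : Fin r → Fin ℓ → Fin n → ZMod k |
        ∀ ν, (ν ∈ S → ∀ j, ∀ u ∈ C ν j, ∑ i, u i * M ν j i = 0) ∧
             (ν ∉ S → ∀ j, M ν j ∈ C ν j)}, ∏ i, x fun ν j => M ν j i) =
      ∑ W : Fin r → Fin ℓ → Fin n → ZMod k,
        (∏ ν, ∏ j, if P ν j (W ν j) then (1 : ℂ) else 0) * ∏ i, x fun ν j => W ν j i := by
    rw [finsum_mem_pi_pi (fun ν j => univ.filter (P ν j)), ← sum_subset (subset_univ _)]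
    · refine sum_congr rfl fun W hW => ?_
      simp only [Fintype.mem_piFinset, mem_filter, mem_univ, true_and] at hW
      simp [hW]
    · intro W _ hW
      simp only [Fintype.mem_piFinset, mem_filter, mem_univ, true_and, not_forall] at hW
      obtain ⟨ν, j, hP⟩ := hW
      rw [prod_eq_zero (mem_univ ν) (prod_eq_zero (mem_univ j) (if_neg hP)), zero_mul]
    · intro M
      simp only [mem_filter, mem_univ, true_and, P, Set.mem_ofPred_eq]
      exact forall_congr' fun ν => by by_cases h : ν ∈ S <;> simp [h]
  have htransform (M : Fin r → Fin ℓ → Fin n → ZMod k) :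
      (∏ i, ∑ v : {ν // ν ∈ S} → Fin ℓ → ZMod k,
        (∏ ν : {ν // ν ∈ S}, η ^ (∑ j, M ν.1 j i * v ν j).val) *
          x fun ν j => if h : ν ∈ S then v ⟨ν, h⟩ j else M ν j i) =
      ∑ W : Fin r → Fin ℓ → Fin n → ZMod k,
        (∏ ν, ∏ j, ∏ i, positionKernel χ (ν ∈ S) (M ν j i) (W ν j i)) *
          ∏ i, x fun ν j => W ν j i := by
    have h (i : Fin n) := sum_dualized_eq_sum_positionKernel χ S (fun ν j => M ν j i) x
    simp only [hχ, AddChar.zmodChar_apply] at h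
    simp only [h, prod_sum_columns]
    refine sum_congr rfl fun W _ => ?_
    rw [prod_mul_distrib, prod_comm]
    congr 1
    refine prod_congr rfl fun ν _ => ?_
    rw [prod_comm]
  rw [hdual, hcard, eq_inv_mul_iff_mul_eq₀ hcard_ne,
    finsum_mem_pi_pi (fun ν j => univ.filter (· ∈ C ν j)) _ (by simp)]
  simp only [htransform]
  rw [sum_comm, mul_sum]
  refine sum_congr rfl fun W _ => ?_
  rw [← sum_mul, ← mul_assoc]
  congr 1
  rw [sum_pi_pi_prod_prod (fun ν j => univ.filter (· ∈ C ν j))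
    fun ν j m => ∏ i, positionKernel χ (ν ∈ S) (m i) (W ν j i)]
  simp only [← prod_mul_distrib]
  refine prod_congr rfl fun ν _ => prod_congr rfl fun j _ => ?_
  convert (sum_positionKernel hη (C ν j) (ν ∈ S) (W ν j)).symm
end

section
/- (Average MacWilliams identity, displayed in Definition 5.4.) Let q be a prime power, χ a nontrivial additive character of F_q into ℂ*, and for k ∈ {1,…,r}, j ∈ {1,…,ℓ} let C_{kj} be F_q-linear codes of length n with ℓ-fold joint codes Π_k^ℓ and duals (Π_k^ℓ)^⊥ as above. For x : (F_q^{ℓ})^r → ℂ define the average (ℓ,r)-fold complete joint weight enumerator J^av(x) := (1/(ℓ!·(n!)^ℓ)) ∑_{ι ∈ S_ℓ ⋉ S_n^ℓ} ∑_{m_1 ∈ ι(Π_1^ℓ), m_2 ∈ Π_2^ℓ, …, m_r ∈ Π_r^ℓ} ∏_{i=1}^{n} x(col_i m_1, …, col_i m_r). Then for every subset S ⊆ {1,…,r} of dualized positions, the average (ℓ,r)-fold complete joint weight enumerator of the joint codes with positions in S replaced by their duals equals (1/∏_{k∈S}|Π_k^ℓ|) times the average (ℓ,r)-fold complete joint weight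 enumerator of the original joint codes evaluated at the transformed variables x′(a_1,…,a_r) := ∑_{(v_k)_{k∈S}} (∏_{k∈S} χ(a_k · v_k)) x(b_1,…,b_r), where b_k := v_k for k ∈ S and b_k := a_k otherwise. -/
/-- Membership of a matrix `mm` in the `ℓ`-fold joint code with rows in `C k j`, dualized at
the positions `k ∈ S`: if `k ∈ S` the rows must lie in the dual codes `C k j ^⊥`, otherwise
in the codes `C k j` themselves. -/
def hatMem {F : Type} [Field F] {n ℓ r : ℕ} (S : Finset (Fin r))
    (C : Fin r → Fin ℓ → Submodule F (Fin n → F)) (k : Fin r)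
    (mm : Fin ℓ → Fin n → F) : Prop :=
  if k ∈ S then ∀ j, ∀ u ∈ C k j, ∑ i, u i * mm j i = 0 else ∀ j, mm j ∈ C k j

/-- The simultaneous action of a row permutation and of a column permutation in each row,
`m ↦ fun j i => m (π j) (σ j i)`, as a bijection on matrices. -/
def rowColPerm {ι κ : Type*} (F : Type*) (π : Equiv.Perm ι) (σ : ι → Equiv.Perm κ) :
    (ι → κ → F) ≃ (ι → κ → F) where
  toFun m j i := m (π j) (σ j i)
  invFun m j i := m (π.symm j) ((σ (π.symm j)).symm i)
  left_inv m := by funext j i; simp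
  right_inv m := by
    funext j i
    simp only [Equiv.symm_apply_apply]

/-- The family of row codes obtained from `D` by permuting the rows by `π` and the
coordinates of the `j`-th row by `σ j`. -/
def permCode {F : Type*} [Field F] {ι κ : Type*} (D : ι → Submodule F (κ → F))
    (π : Equiv.Perm ι) (σ : ι → Equiv.Perm κ) (j : ι) : Submodule F (κ → F) :=
  (D (π j)).comap (LinearMap.funLeft F F (σ j).symm)

lemma mem_permCode {F : Type*} [Field F] {ι κ : Type*} {D : ι → Submodule F (κ → F)}
    {π : Equiv.Perm ι} {σ : ι → Equiv.Perm κ} {j : ι} {u : κ → F} :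
    u ∈ permCode D π σ j ↔ (fun i => u ((σ j).symm i)) ∈ D (π j) := Iff.rfl

lemma rowColPerm_symm_forall_mem_iff {F : Type*} [Field F] {ι κ : Type*}
    (D : ι → Submodule F (κ → F)) (π : Equiv.Perm ι) (σ : ι → Equiv.Perm κ) (m : ι → κ → F) :
    (∀ j, (rowColPerm F π σ).symm m j ∈ D j) ↔ ∀ j, m j ∈ permCode D π σ j := by
  simp only [mem_permCode]
  rw [← π.forall_congr_right]
  simp [rowColPerm]

lemma rowColPerm_symm_forall_dual_iff {F : Type*} [Field F] {ι κ : Type*} [Fintype κ]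
    (D : ι → Submodule F (κ → F)) (π : Equiv.Perm ι) (σ : ι → Equiv.Perm κ) (m : ι → κ → F) :
    (∀ j, ∀ u ∈ D j, ∑ i, u i * (rowColPerm F π σ).symm m j i = 0) ↔
      ∀ j, ∀ u ∈ permCode D π σ j, ∑ i, u i * m j i = 0 := by
  rw [← π.forall_congr_right]
  refine forall_congr' fun j => ?_
  constructor
  · intro h u hu
    have := h _ (mem_permCode.1 hu)
    rw [← this, ← Equiv.sum_comp (σ j).symm]
    simp [rowColPerm]
  · intro h u hu
    have hu' : (fun i => u (σ j i)) ∈ permCode D π σ j := by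
      rw [mem_permCode]; simpa using hu
    rw [← h _ hu', ← Equiv.sum_comp (σ j)]
    simp [rowColPerm]

lemma natCard_permCode {F : Type*} [Field F] {ι κ : Type*}
    (D : ι → Submodule F (κ → F)) (π : Equiv.Perm ι) (σ : ι → Equiv.Perm κ) :
    Nat.card {m : ι → κ → F // ∀ j, m j ∈ permCode D π σ j} =
      Nat.card {m : ι → κ → F // ∀ j, m j ∈ D j} :=
  Nat.card_congr ((rowColPerm F π σ).symm.subtypeEquiv fun m =>
    (rowColPerm_symm_forall_mem_iff D π σ m).symm)

/-- Orthogonality of characters for a matrix code with prescribed row codes. -/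
lemma sum_addChar_joint_code {F : Type*} [Field F] [Fintype F] {ι κ : Type*} [Fintype ι]
    [DecidableEq ι] [Fintype κ] [DecidableEq κ] (χ : AddChar F ℂ) (hχ : ∃ a, χ a ≠ 1) (D : ι → Submodule F (κ → F))
    (N : ι → κ → F) [DecidablePred fun M : ι → κ → F => ∀ j, M j ∈ D j]
    [Decidable (∀ j, ∀ u ∈ D j, ∑ i, u i * N j i = 0)] :
    ∑ M : ι → κ → F with ∀ j, M j ∈ D j, χ (∑ j, ∑ i, M j i * N j i) =
      if ∀ j, ∀ u ∈ D j, ∑ i, u i * N j i = 0 then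
        (Nat.card {m : ι → κ → F // ∀ j, m j ∈ D j} : ℂ) else 0 := by
  split_ifs with h
  · rw [Finset.sum_congr rfl (g := fun _ => (1 : ℂ))]
    · rw [Finset.sum_const, nsmul_one, Nat.card_eq_fintype_card, Fintype.card_subtype]
    · intro M hM
      rw [Finset.sum_eq_zero fun j _ => h j _ ((Finset.mem_filter.1 hM).2 j)]
      simp
  · push Not at h
    obtain ⟨j, u, hu, hne⟩ := h
    obtain ⟨a, ha⟩ := hχ
    set b := ∑ i, u i * N j i
    set T : ι → κ → F := Pi.single j ((a * b⁻¹) • u)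
    have hT : ∀ j', T j' ∈ D j' := by
      intro j'
      by_cases e : j' = j
      · subst e; simpa [T] using (D j').smul_mem _ hu
      · simp [T, e]
    have hval : ∑ j', ∑ i, T j' i * N j' i = a := by
      rw [Finset.sum_eq_single j]
      · simp only [T, Pi.single_eq_same, Pi.smul_apply, smul_eq_mul, mul_assoc, ← Finset.mul_sum]
        rw [inv_mul_cancel₀ hne, mul_one]
      · intro j' _ e; simp [T, e]
      · simp
    set s := ∑ M : ι → κ → F with ∀ j, M j ∈ D j, χ (∑ j, ∑ i, M j i * N j i)
    have hs : s = χ a * s := by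
      rw [Finset.mul_sum]
      symm
      refine Finset.sum_equiv (Equiv.addLeft T) (fun M => ?_) fun M _ => ?_
      · simp only [Finset.mem_filter_univ, Equiv.coe_addLeft, Pi.add_apply]
        exact forall_congr' fun j' => ((D j').add_mem_iff_right (hT j')).symm
      · rw [← hval, ← AddChar.map_add_eq_mul]
        simp [add_mul, Finset.sum_add_distrib]
    have : (1 - χ a) * s = 0 := by linear_combination hs
    exact (mul_eq_zero.1 this).resolve_left (sub_ne_zero.2 ha.symm)

/-- Summing out the coordinates outside `S`, which are pinned to the values `a k`. -/
lemma sum_prod_ite_eq {K V R : Type*} [Fintype K] [DecidableEq K] [Fintype V] [DecidableEq V]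
    [CommSemiring R] (S : Finset K) (a : K → V) (f : K → V → R) (y : (K → V) → R) :
    ∑ w : K → V, (∏ k, if k ∈ S then f k (w k) else if a k = w k then 1 else 0) * y w =
      ∑ v : {k // k ∈ S} → V, (∏ k : {k // k ∈ S}, f k.1 (v k)) *
        y fun k => if h : k ∈ S then v ⟨k, h⟩ else a k := by
  symm
  refine Finset.sum_of_injOn (fun v k => if h : k ∈ S then v ⟨k, h⟩ else a k) ?_ ?_ ?_ ?_
  · intro v _ w _ h
    funext k
    simpa [k.2] using congrFun h k.1
  · intro v _; simp
  · intro w _ hw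
    have : ∃ k, k ∉ S ∧ a k ≠ w k := by
      by_contra! hcon
      refine hw ⟨fun k => w k.1, by simp, ?_⟩
      funext k
      by_cases hk : k ∈ S
      · simp [hk]
      · simp [hk, hcon k hk]
    obtain ⟨k, hk, hne⟩ := this
    rw [Finset.prod_eq_zero (Finset.mem_univ k) (by simp [hk, hne]), zero_mul]
  · intro v _
    congr 1
    rw [← Finset.prod_subset (Finset.subset_univ S), ← Finset.prod_coe_sort S]
    · exact Finset.prod_congr rfl fun k _ => by simp
    · intro k _ hk; simp [hk]

/-- The MacWilliams identity for the complete joint weight enumerator of `K`-indexed joint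
codes, dualized at the positions in `S`. -/
theorem joint_macwilliams_identity {F : Type} [Field F] [Fintype F] [DecidableEq F] {n ℓ r : ℕ}
    (χ : AddChar F ℂ) (hχ : ∃ a, χ a ≠ 1) (E : Fin r → Fin ℓ → Submodule F (Fin n → F))
    (S : Finset (Fin r)) (x : (Fin r → Fin ℓ → F) → ℂ) :
    ∑ᶠ M ∈ {M : Fin r → Fin ℓ → Fin n → F | ∀ k, hatMem S E k (M k)},
        ∏ i, x (fun k j => M k j i) =
      (∏ k ∈ S, (Nat.card {m : Fin ℓ → Fin n → F // ∀ j, m j ∈ E k j} : ℂ))⁻¹ *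
      ∑ᶠ M ∈ {M : Fin r → Fin ℓ → Fin n → F | ∀ k j, M k j ∈ E k j},
        ∏ i, ∑ v : {k // k ∈ S} → Fin ℓ → F,
          (∏ k : {k // k ∈ S}, χ (∑ j, M k.1 j i * v k j)) *
            x fun k j => if h : k ∈ S then v ⟨k, h⟩ j else M k j i := by
  classical
  set card : Fin r → ℂ := fun k => Nat.card {m : Fin ℓ → Fin n → F // ∀ j, m j ∈ E k j}
  have hcard : ∀ k, card k ≠ 0 := fun k => by
    have : Nonempty {m : Fin ℓ → Fin n → F // ∀ j, m j ∈ E k j} := ⟨0, fun j => (E k j).zero_mem⟩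
    exact Nat.cast_ne_zero.2 Nat.card_pos.ne'
  -- The kernel attached to position `k`: a character on `S`, a delta function off `S`.
  let t (k : Fin r) (M N : Fin ℓ → Fin n → F) : ℂ :=
    ∏ i, if k ∈ S then χ (∑ j, M j i * N j i) else
      if (fun j => M j i) = (fun j => N j i) then 1 else 0
  have ht (k) (N : Fin ℓ → Fin n → F) :
      ∑ M : Fin ℓ → Fin n → F with ∀ j, M j ∈ E k j, t k M N =
        (if k ∈ S then card k else 1) * if hatMem S E k N then 1 else 0 := by
    by_cases hk : k ∈ S
    · have : ∀ M, t k M N = χ (∑ j, ∑ i, M j i * N j i) := fun M => by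
        rw [Finset.sum_comm]
        simp only [t, hk, if_true]
        exact (map_prod χ.toMonoidHom
          (fun i => Multiplicative.ofAdd (∑ j, M j i * N j i)) Finset.univ).symm
      simp only [this, sum_addChar_joint_code χ hχ, hatMem, hk, if_true, card]
      simp
    · have : ∀ M, t k M N = if M = N then 1 else 0 := fun M => by
        simp only [t, hk, if_false, Finset.prod_ite_zero, Finset.prod_const_one]
        congr 1
        simp only [Finset.mem_univ, forall_true_left, funext_iff, eq_iff_iff]
        exact forall_comm
      simp [this, hatMem, hk]
  have hprod (N : Fin r → Fin ℓ → Fin n → F) :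
      ∑ M ∈ Fintype.piFinset fun k => {M : Fin ℓ → Fin n → F | ∀ j, M j ∈ E k j},
        ∏ k, t k (M k) (N k) =
      (∏ k ∈ S, card k) * if ∀ k, hatMem S E k (N k) then 1 else 0 := by
    rw [← Finset.prod_univ_sum _ fun k M => t k M (N k)]
    simp only [ht, Finset.prod_mul_distrib, Finset.prod_ite_zero, Finset.prod_const_one]
    simp
  have hfactor (M : Fin r → Fin ℓ → Fin n → F) :
      ∑ N : Fin r → Fin ℓ → Fin n → F, (∏ k, t k (M k) (N k)) * ∏ i, x (fun k j => N k j i) =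
      ∏ i, ∑ v : {k // k ∈ S} → Fin ℓ → F,
          (∏ k : {k // k ∈ S}, χ (∑ j, M k.1 j i * v k j)) *
            x fun k j => if h : k ∈ S then v ⟨k, h⟩ j else M k j i := by
    have hsum (i : Fin n) := sum_prod_ite_eq S (fun k j => M k j i)
      (fun k w => χ (∑ j, M k j i * w j)) x
    have happ (i : Fin n) (v : {k // k ∈ S} → Fin ℓ → F) :
        (fun k => if h : k ∈ S then v ⟨k, h⟩ else fun j => M k j i) =
          fun k j => if h : k ∈ S then v ⟨k, h⟩ j else M k j i := by
      funext k j; split_ifs <;> rfl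
    simp only [happ] at hsum
    simp only [← hsum, Fintype.prod_sum]
    let e : (Fin r → Fin ℓ → Fin n → F) ≃ (Fin n → Fin r → Fin ℓ → F) :=
      { toFun := fun N i k j => N k j i
        invFun := fun W k j i => W i k j
        left_inv := fun _ => rfl
        right_inv := fun _ => rfl }
    refine Fintype.sum_equiv e _ _ fun N => ?_
    simp only [t, Finset.prod_mul_distrib]
    rw [Finset.prod_comm]
    rfl
  rw [finsum_mem_eq_toFinset_sum, finsum_mem_eq_toFinset_sum]
  have hset : {M : Fin r → Fin ℓ → Fin n → F | ∀ k j, M k j ∈ E k j}.toFinset =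
      Fintype.piFinset fun k => {M : Fin ℓ → Fin n → F | ∀ j, M j ∈ E k j} := by
    ext M; simp
  rw [hset, eq_inv_mul_iff_mul_eq₀ (Finset.prod_ne_zero_iff.2 fun k _ => hcard k)]
  simp only [← hfactor]
  rw [Finset.sum_comm]
  simp only [← Finset.sum_mul, hprod]
  simp only [mul_assoc, ← Finset.mul_sum, ite_mul, one_mul, zero_mul]
  rw [← Finset.sum_filter]
  congr 2
  ext M; simp

/-- Average MacWilliams identity (displayed in Definition 5.4): the average `(ℓ,r)`-fold
complete joint weight enumerator of the joint codes with the positions in `S` dualized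
equals `1/∏_{k ∈ S} |Π_k^ℓ|` times the average `(ℓ,r)`-fold complete joint weight
enumerator of the original joint codes at the character-transformed variables.  The
averaging is over the first joint code's equivalence class under `S_ℓ ⋉ S_n^ℓ`; joint codes
are indexed by `Fin (r + 1)`, index `0` being the averaged one. -/
theorem average_macwilliams_identity (q n ℓ r : ℕ) (hq : IsPrimePow q)
    (F : Type) [Field F] [Fintype F] [DecidableEq F] (hF : Fintype.card F = q)
    (χ : AddChar F ℂ) (hχ : ∃ a, χ a ≠ 1)
    (C : Fin (r + 1) → Fin ℓ → Submodule F (Fin n → F))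
    (S : Finset (Fin (r + 1)))
    (x : (Fin (r + 1) → Fin ℓ → F) → ℂ) :
    ((Nat.factorial ℓ : ℂ) * (Nat.factorial n : ℂ) ^ ℓ)⁻¹ *
    (∑ ι : Equiv.Perm (Fin ℓ) × (Fin ℓ → Equiv.Perm (Fin n)),
      ∑ᶠ M ∈ {M : Fin (r + 1) → Fin ℓ → Fin n → F |
          (∃ m0 : Fin ℓ → Fin n → F, hatMem S C 0 m0 ∧
            M 0 = fun j i => m0 (ι.1 j) (ι.2 j i)) ∧
          ∀ k : Fin r, hatMem S C k.succ (M k.succ)},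
        ∏ i, x fun k j => M k j i)
    =
    (∏ k ∈ S, (Nat.card {mm : Fin ℓ → Fin n → F // ∀ j, mm j ∈ C k j} : ℂ))⁻¹ *
    (((Nat.factorial ℓ : ℂ) * (Nat.factorial n : ℂ) ^ ℓ)⁻¹ *
    (∑ ι : Equiv.Perm (Fin ℓ) × (Fin ℓ → Equiv.Perm (Fin n)),
      ∑ᶠ M ∈ {M : Fin (r + 1) → Fin ℓ → Fin n → F |
          (∃ m0 : Fin ℓ → Fin n → F, (∀ j, m0 j ∈ C 0 j) ∧
            M 0 = fun j i => m0 (ι.1 j) (ι.2 j i)) ∧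
          ∀ k : Fin r, ∀ j, M k.succ j ∈ C k.succ j},
        ∏ i, ∑ v : {k // k ∈ S} → Fin ℓ → F,
          (∏ k : {k // k ∈ S}, χ (∑ j, M k.1 j i * v k j)) *
            x fun k j => if h : k ∈ S then v ⟨k, h⟩ j else M k j i)) := by
  rw [mul_left_comm]
  congr 1
  rw [Finset.mul_sum]
  refine Finset.sum_congr rfl fun ι _ => ?_
  set E : Fin (r + 1) → Fin ℓ → Submodule F (Fin n → F) :=
    Fin.cons (permCode (C 0) ι.1 ι.2) fun k => C k.succ with hE
  have hex (P : (Fin ℓ → Fin n → F) → Prop) (m : Fin ℓ → Fin n → F) :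
      (∃ m0, P m0 ∧ m = fun j i => m0 (ι.1 j) (ι.2 j i)) ↔
        P ((rowColPerm F ι.1 ι.2).symm m) := by
    constructor
    · rintro ⟨m0, h, rfl⟩
      exact ((rowColPerm F ι.1 ι.2).symm_apply_apply m0).symm ▸ h
    · exact fun h => ⟨_, h, ((rowColPerm F ι.1 ι.2).apply_symm_apply m).symm⟩
  have hhat (M : Fin (r + 1) → Fin ℓ → Fin n → F) :
      ((∃ m0 : Fin ℓ → Fin n → F, hatMem S C 0 m0 ∧
            M 0 = fun j i => m0 (ι.1 j) (ι.2 j i)) ∧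
          ∀ k : Fin r, hatMem S C k.succ (M k.succ)) ↔ ∀ k, hatMem S E k (M k) := by
    rw [hex (hatMem S C 0), Fin.forall_fin_succ]
    refine and_congr ?_ Iff.rfl
    simp only [hatMem, hE, Fin.cons_zero]
    split_ifs
    · exact rowColPerm_symm_forall_dual_iff (C 0) ι.1 ι.2 (M 0)
    · exact rowColPerm_symm_forall_mem_iff (C 0) ι.1 ι.2 (M 0)
  have hmem (M : Fin (r + 1) → Fin ℓ → Fin n → F) :
      ((∃ m0 : Fin ℓ → Fin n → F, (∀ j, m0 j ∈ C 0 j) ∧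
            M 0 = fun j i => m0 (ι.1 j) (ι.2 j i)) ∧
          ∀ k : Fin r, ∀ j, M k.succ j ∈ C k.succ j) ↔ ∀ k j, M k j ∈ E k j := by
    rw [hex fun m0 => ∀ j, m0 j ∈ C 0 j, Fin.forall_fin_succ,
      rowColPerm_symm_forall_mem_iff (C 0) ι.1 ι.2 (M 0)]
    rfl
  have hcard (k : Fin (r + 1)) : Nat.card {m : Fin ℓ → Fin n → F // ∀ j, m j ∈ E k j} =
      Nat.card {m : Fin ℓ → Fin n → F // ∀ j, m j ∈ C k j} := by
    refine Fin.cases ?_ (fun k => ?_) k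
    · exact natCard_permCode (C 0) ι.1 ι.2
    · rfl
  simp only [hhat, hmem, ← hcard]
  exact joint_macwilliams_identity χ hχ E S x
end
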